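/- arXiv:2005.06163 — 5 statements merged into one kernel-verified Lean document; each statement's English description precedes it below -/
import Mathlib

section
/- Let C be the middle-third Cantor set and let f ∈ C³(ℝ²). Suppose that for every (x,y) ∈ [0,1]²: ∂_x f(x,y) > 0, ∂_y f(x,y) > 0, ∂_{xx}f(x,y) − 6∂_{xy}f(x,y) + 9∂_{yy}f(x,y) ≥ 0, ∂_{xx}f(x,y) − 2∂_{xy}f(x,y) + ∂_{yy}f(x,y) ≥ 0, and 1/3 ≤ ∂_y f(x,y)/∂_x f(x,y) ≤ 1. Then f(C, C) = {f(x,y) : x, y ∈ C} is a closed interval. -/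
/-- First-order partial derivative in `x` of `f : ℝ² → ℝ`. -/
noncomputable def pdx (f : ℝ × ℝ → ℝ) (p : ℝ × ℝ) : ℝ := fderiv ℝ f p (1, 0)

/-- First-order partial derivative in `y` of `f : ℝ² → ℝ`. -/
noncomputable def pdy (f : ℝ × ℝ → ℝ) (p : ℝ × ℝ) : ℝ := fderiv ℝ f p (0, 1)

/-- Second-order partial derivative `∂_{xx} f`. -/
noncomputable def pdxx (f : ℝ × ℝ → ℝ) (p : ℝ × ℝ) : ℝ := fderiv ℝ (pdx f) p (1, 0)

/-- Second-order partial derivative `∂_{xy} f`. -/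
noncomputable def pdxy (f : ℝ × ℝ → ℝ) (p : ℝ × ℝ) : ℝ := fderiv ℝ (pdx f) p (0, 1)

/-- Second-order partial derivative `∂_{yy} f`. -/
noncomputable def pdyy (f : ℝ × ℝ → ℝ) (p : ℝ × ℝ) : ℝ := fderiv ℝ (pdy f) p (0, 1)

/-- `(ℓ₁∂_x + ℓ₂∂_y)² f = ℓ₁²∂_{xx}f + 2ℓ₁ℓ₂∂_{xy}f + ℓ₂²∂_{yy}f`. -/
noncomputable def quadOp (l₁ l₂ : ℝ) (f : ℝ × ℝ → ℝ) (p : ℝ × ℝ) : ℝ :=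
  l₁ ^ 2 * pdxx f p + 2 * l₁ * l₂ * pdxy f p + l₂ ^ 2 * pdyy f p


lemma aux_mono (f : ℝ × ℝ → ℝ) (hf : ContDiff ℝ 3 f) (a b c d : ℝ)
    (h1 : (a, b) ∈ (Set.Icc 0 1 ×ˢ Set.Icc 0 1 : Set (ℝ × ℝ)))
    (h2 : (a + c, b + d) ∈ (Set.Icc 0 1 ×ˢ Set.Icc 0 1 : Set (ℝ × ℝ)))
    (h : ∀ p ∈ (Set.Icc 0 1 ×ˢ Set.Icc 0 1 : Set (ℝ × ℝ)), 0 ≤ c * pdx f p + d * pdy f p) :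
    f (a, b) ≤ f (a + c, b + d) := by
  have hd : Differentiable ℝ f := hf.differentiable (by norm_num)
  have hconv : Convex ℝ (Set.Icc 0 1 ×ˢ Set.Icc 0 1 : Set (ℝ × ℝ)) :=
    (convex_Icc 0 1).prod (convex_Icc 0 1)
  obtain ⟨z, hz, hz'⟩ := domain_mvt (f := f) (f' := fderiv ℝ f)
    (fun x _ => (hd x).hasFDerivAt.hasFDerivWithinAt) hconv h1 h2
  have h3 := h z (hconv.segment_subset h1 h2 hz)
  have h4 : ((a + c, b + d) : ℝ × ℝ) - (a, b) = c • ((1, 0) : ℝ × ℝ) + d • ((0, 1) : ℝ × ℝ) := by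
    ext <;> simp
  rw [h4, map_add, map_smul, map_smul] at hz'
  simp only [pdx, pdy, smul_eq_mul] at h3 hz'
  linarith

lemma aux_level (f : ℝ × ℝ → ℝ) (hf : ContDiff ℝ 3 f)
    (hxy : ∀ p ∈ (Set.Icc 0 1 ×ˢ Set.Icc 0 1 : Set (ℝ × ℝ)), pdy f p ≤ pdx f p)
    (hyx : ∀ p ∈ (Set.Icc 0 1 ×ˢ Set.Icc 0 1 : Set (ℝ × ℝ)), pdx f p ≤ 3 * pdy f p)
    (t : ℝ) (n : ℕ) : ∀ a b h : ℝ, 0 ≤ a → 0 ≤ b → 0 ≤ h → a + h ≤ 1 → b + h ≤ 1 →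
      f (a, b) ≤ t → t ≤ f (a + h, b + h) →
      ∃ u ∈ preCantorSet n, ∃ v ∈ preCantorSet n, f (a + h * u, b + h * v) = t := by
  induction n with
  | zero =>
    intro a b h ha hb hh hah hbh h1 h2
    have hc : ContinuousOn (fun s : ℝ => f (a + h * s, b + h * s)) (Set.Icc 0 1) :=
      (hf.continuous.comp (by fun_prop)).continuousOn
    obtain ⟨s, hs, hs'⟩ := intermediate_value_Icc (zero_le_one) hc
      (show t ∈ Set.Icc _ _ from ⟨by simpa using h1, by simpa using h2⟩)
    exact ⟨s, hs, s, hs, hs'⟩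
  | succ n ih =>
    intro a b h ha hb hh hah hbh h1 h2
    have key : ∀ i j : ℝ, (i = 0 ∨ i = 2) → (j = 0 ∨ j = 2) →
        f (a + i * h / 3, b + j * h / 3) ≤ t →
        t ≤ f (a + i * h / 3 + h / 3, b + j * h / 3 + h / 3) →
        ∃ u ∈ preCantorSet (n + 1), ∃ v ∈ preCantorSet (n + 1),
          f (a + h * u, b + h * v) = t := by
      have mem : ∀ i u : ℝ, (i = 0 ∨ i = 2) → u ∈ preCantorSet n →
          (i + u) / 3 ∈ preCantorSet (n + 1) := by
        rintro i u (rfl | rfl) hu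
        · exact Or.inl ⟨u, hu, by simp⟩
        · exact Or.inr ⟨u, hu, rfl⟩
      intro i j hi hj hl hr
      have hi' : 0 ≤ i ∧ i ≤ 2 := by rcases hi with rfl | rfl <;> norm_num
      have hj' : 0 ≤ j ∧ j ≤ 2 := by rcases hj with rfl | rfl <;> norm_num
      have p1 := mul_nonneg hi'.1 hh
      have p2 := mul_nonneg hj'.1 hh
      have p3 := mul_le_mul_of_nonneg_right hi'.2 hh
      have p4 := mul_le_mul_of_nonneg_right hj'.2 hh
      obtain ⟨u, hu, v, hv, huv⟩ := ih (a + i * h / 3) (b + j * h / 3) (h / 3)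
        (by linarith) (by linarith) (by linarith) (by linarith) (by linarith) hl hr
      refine ⟨_, mem i u hi hu, _, mem j v hj hv, ?_⟩
      rw [← huv]
      congr 2 <;> ring
    have m1 := aux_mono f hf a (b + 2 * h / 3) (h / 3) (-(h / 3))
      ⟨⟨by simp; linarith, by simp; linarith⟩, ⟨by simp; linarith, by simp; linarith⟩⟩
      ⟨⟨by simp; linarith, by simp; linarith⟩, ⟨by simp; linarith, by simp; linarith⟩⟩
      (fun p hp => by nlinarith [mul_nonneg hh (sub_nonneg.2 (hxy p hp))])
    have m2 := aux_mono f hf (a + 2 * h / 3) b (-(h / 3)) h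
      ⟨⟨by simp; linarith, by simp; linarith⟩, ⟨by simp; linarith, by simp; linarith⟩⟩
      ⟨⟨by simp; linarith, by simp; linarith⟩, ⟨by simp; linarith, by simp; linarith⟩⟩
      (fun p hp => by nlinarith [mul_nonneg hh (sub_nonneg.2 (hyx p hp))])
    have m3 := aux_mono f hf (a + 2 * h / 3) (b + 2 * h / 3) (h / 3) (-(h / 3))
      ⟨⟨by simp; linarith, by simp; linarith⟩, ⟨by simp; linarith, by simp; linarith⟩⟩
      ⟨⟨by simp; linarith, by simp; linarith⟩, ⟨by simp; linarith, by simp; linarith⟩⟩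
      (fun p hp => by nlinarith [mul_nonneg hh (sub_nonneg.2 (hxy p hp))])
    have fe : ∀ x y x' y' : ℝ, x = x' → y = y' → f (x, y) = f (x', y') := by
      rintro x y _ _ rfl rfl; rfl
    rcases le_total t (f (a + h / 3, b + h / 3)) with c1 | c1
    · refine key 0 0 (Or.inl rfl) (Or.inl rfl) ?_ ?_
      · exact (fe _ _ _ _ (by ring) (by ring)).trans_le h1
      · exact c1.trans_eq (fe _ _ _ _ (by ring) (by ring))
    rcases le_total t (f (a + h / 3, b + h)) with c2 | c2
    · refine key 0 2 (Or.inl rfl) (Or.inr rfl) ?_ ?_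
      · exact (fe _ _ _ _ (by ring) (by ring)).trans_le
          ((m1.trans_eq (fe _ _ _ _ (by ring) (by ring))).trans c1)
      · exact c2.trans_eq (fe _ _ _ _ (by ring) (by ring))
    rcases le_total t (f (a + h, b + h / 3)) with c3 | c3
    · refine key 2 0 (Or.inr rfl) (Or.inl rfl) ?_ ?_
      · exact (fe _ _ _ _ (by ring) (by ring)).trans_le
          ((m2.trans_eq (fe _ _ _ _ (by ring) (by ring))).trans c2)
      · exact c3.trans_eq (fe _ _ _ _ (by ring) (by ring))
    · refine key 2 2 (Or.inr rfl) (Or.inr rfl) ?_ ?_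
      · exact (m3.trans_eq (fe _ _ _ _ (by ring) (by ring))).trans c3
      · exact h2.trans_eq (fe _ _ _ _ (by ring) (by ring))

theorem stmt_11 (f : ℝ × ℝ → ℝ) (hf : ContDiff ℝ 3 f)
    (hx : ∀ p ∈ Set.Icc 0 1 ×ˢ Set.Icc 0 1, 0 < pdx f p)
    (hy : ∀ p ∈ Set.Icc 0 1 ×ˢ Set.Icc 0 1, 0 < pdy f p)
    (hQ1 : ∀ p ∈ Set.Icc 0 1 ×ˢ Set.Icc 0 1,
      0 ≤ pdxx f p - 6 * pdxy f p + 9 * pdyy f p)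
    (hQ2 : ∀ p ∈ Set.Icc 0 1 ×ˢ Set.Icc 0 1,
      0 ≤ pdxx f p - 2 * pdxy f p + pdyy f p)
    (hratio : ∀ p ∈ Set.Icc 0 1 ×ˢ Set.Icc 0 1,
      1 / 3 ≤ pdy f p / pdx f p ∧ pdy f p / pdx f p ≤ 1) :
    ∃ a b : ℝ, a ≤ b ∧ f '' (cantorSet ×ˢ cantorSet) = Set.Icc a b := by
  have hxy : ∀ p ∈ (Set.Icc 0 1 ×ˢ Set.Icc 0 1 : Set (ℝ × ℝ)), pdy f p ≤ pdx f p := fun p hp => by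
    have := (div_le_iff₀ (hx p hp)).1 (hratio p hp).2
    linarith
  have hyx : ∀ p ∈ (Set.Icc 0 1 ×ˢ Set.Icc 0 1 : Set (ℝ × ℝ)), pdx f p ≤ 3 * pdy f p :=
    fun p hp => by
      have := (le_div_iff₀ (hx p hp)).1 (hratio p hp).1
      linarith
  have mono : ∀ a b c d : ℝ, 0 ≤ a → 0 ≤ b → a ≤ c → b ≤ d → c ≤ 1 → d ≤ 1 →
      f (a, b) ≤ f (c, d) := by
    intro a b c d ha hb hac hbd hc hd
    have := aux_mono f hf a b (c - a) (d - b)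
      ⟨⟨ha, hac.trans hc⟩, ⟨hb, hbd.trans hd⟩⟩
      ⟨⟨by simp; linarith, by simp; linarith⟩, ⟨by simp; linarith, by simp; linarith⟩⟩
      (fun p hp => add_nonneg (mul_nonneg (by linarith) (hx p hp).le)
        (mul_nonneg (by linarith) (hy p hp).le))
    simpa using this
  refine ⟨f (0, 0), f (1, 1), mono _ _ _ _ le_rfl le_rfl zero_le_one zero_le_one le_rfl le_rfl,
    Set.Subset.antisymm ?_ ?_⟩
  · rintro _ ⟨⟨u, v⟩, ⟨hu, hv⟩, rfl⟩
    obtain ⟨hu0, hu1⟩ := cantorSet_subset_unitInterval hu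
    obtain ⟨hv0, hv1⟩ := cantorSet_subset_unitInterval hv
    exact ⟨mono _ _ _ _ le_rfl le_rfl hu0 hv0 hu1 hv1, mono _ _ _ _ hu0 hv0 hu1 hv1 le_rfl le_rfl⟩
  · rintro t ⟨ht0, ht1⟩
    have hcl : ∀ n, IsClosed ((preCantorSet n ×ˢ preCantorSet n) ∩ f ⁻¹' {t}) := fun n =>
      ((isClosed_preCantorSet n).prod (isClosed_preCantorSet n)).inter
        (isClosed_singleton.preimage hf.continuous)
    have hne := IsCompact.nonempty_iInter_of_sequence_nonempty_isCompact_isClosed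
      (fun n => (preCantorSet n ×ˢ preCantorSet n) ∩ f ⁻¹' {t})
      (fun n => Set.inter_subset_inter_left _ (Set.prod_mono
        (preCantorSet_antitone n.le_succ) (preCantorSet_antitone n.le_succ)))
      (fun n => by
        obtain ⟨u, hu, v, hv, huv⟩ := aux_level f hf hxy hyx t n 0 0 1 le_rfl le_rfl zero_le_one
          (by norm_num) (by norm_num) ht0 (by simpa using ht1)
        exact ⟨(u, v), ⟨hu, hv⟩, by simpa using huv⟩)
      ((isCompact_Icc.prod isCompact_Icc).of_isClosed_subset (hcl 0) Set.inter_subset_left)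
      hcl
    obtain ⟨p, hp⟩ := hne
    rw [Set.mem_iInter] at hp
    exact ⟨p, ⟨Set.mem_iInter.2 fun n => (hp n).1.1, Set.mem_iInter.2 fun n => (hp n).1.2⟩,
      (hp 0).2⟩
end

section
/- Let C be the middle-third Cantor set and let f ∈ C³(ℝ²). Suppose that for every (x,y) ∈ [0,1]²: ∂_x f(x,y) > 0, ∂_y f(x,y) > 0, ∂_{xx}f(x,y) ≥ 0, ∂_{xy}f(x,y) ≤ 0, ∂_{yy}f(x,y) ≥ 0, and 1/3 ≤ ∂_y f(x,y)/∂_x f(x,y) ≤ 1. Then f(C, C) = {f(x,y) : x, y ∈ C} is a closed interval. -/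
/-- `g` is continuous and monotone along the cone generated by `(1,-1)` and `(-1,3)`. -/
def ConeMono (g : ℝ × ℝ → ℝ) : Prop :=
  Continuous g ∧ ∀ x y x' y' : ℝ, x ∈ Set.Icc (0:ℝ) 1 → y ∈ Set.Icc (0:ℝ) 1 →
    x' ∈ Set.Icc (0:ℝ) 1 → y' ∈ Set.Icc (0:ℝ) 1 →
    0 ≤ (x' - x) + (y' - y) → 0 ≤ 3 * (x' - x) + (y' - y) → g (x, y) ≤ g (x', y')

lemma ConeMono.rescale {g : ℝ × ℝ → ℝ} (h : ConeMono g) (i j : ℝ)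
    (hi : i ∈ Set.Icc (0:ℝ) 2) (hj : j ∈ Set.Icc (0:ℝ) 2) :
    ConeMono (fun p => g ((i + p.1) / 3, (j + p.2) / 3)) := by
  obtain ⟨hc, hm⟩ := h
  refine ⟨hc.comp (by fun_prop), ?_⟩
  rintro x y x' y' ⟨_, _⟩ ⟨_, _⟩ ⟨_, _⟩ ⟨_, _⟩ h1 h2
  obtain ⟨_, _⟩ := hi
  obtain ⟨_, _⟩ := hj
  apply hm <;> first | constructor <;> linarith | linarith

lemma ConeMono.surj (n : ℕ) : ∀ {g : ℝ × ℝ → ℝ}, ConeMono g → ∀ z : ℝ,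
    g (0, 0) ≤ z → z ≤ g (1, 1) →
    ∃ x ∈ preCantorSet n, ∃ y ∈ preCantorSet n, g (x, y) = z := by
  induction n with
  | zero =>
    intro g hg z h0 h1
    have hc : ContinuousOn (fun t : ℝ => g (t, t)) (Set.Icc 0 1) :=
      (hg.1.comp (by fun_prop)).continuousOn
    obtain ⟨t, ht, hz⟩ := intermediate_value_Icc (zero_le_one) hc ⟨h0, h1⟩
    exact ⟨t, ht, t, ht, hz⟩
  | succ n ih =>
    intro g hg z h0 h1
    have key : ∀ i j : ℝ, (i = 0 ∨ i = 2) → (j = 0 ∨ j = 2) →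
        g (i / 3, j / 3) ≤ z → z ≤ g ((i + 1) / 3, (j + 1) / 3) →
        ∃ x ∈ preCantorSet (n + 1), ∃ y ∈ preCantorSet (n + 1), g (x, y) = z := by
      intro i j hi hj hl hu
      obtain ⟨x, hx, y, hy, hz⟩ := ih (hg.rescale i j
        (by rcases hi with rfl | rfl <;> norm_num) (by rcases hj with rfl | rfl <;> norm_num)) z
        (by simpa using hl) hu
      have mem : ∀ k w : ℝ, (k = 0 ∨ k = 2) → w ∈ preCantorSet n →
          (k + w) / 3 ∈ preCantorSet (n + 1) := by
        rintro k w (rfl | rfl) hw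
        · exact Or.inl ⟨w, hw, by simp⟩
        · exact Or.inr ⟨w, hw, rfl⟩
      exact ⟨_, mem i x hi hx, _, mem j y hj hy, hz⟩
    have e1 : g (0 / 3, 2 / 3) ≤ g ((0 + 1) / 3, (0 + 1) / 3) := by
      apply hg.2 <;> norm_num
    have e2 : g (2 / 3, 0 / 3) ≤ g ((0 + 1) / 3, (2 + 1) / 3) := by
      apply hg.2 <;> norm_num
    have e3 : g (2 / 3, 2 / 3) ≤ g ((2 + 1) / 3, (0 + 1) / 3) := by
      apply hg.2 <;> norm_num
    by_cases c1 : z ≤ g ((0 + 1) / 3, (0 + 1) / 3)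
    · exact key 0 0 (by simp) (by simp) (by simpa using h0) c1
    by_cases c2 : z ≤ g ((0 + 1) / 3, (2 + 1) / 3)
    · exact key 0 2 (by simp) (by simp) (by linarith) c2
    by_cases c3 : z ≤ g ((2 + 1) / 3, (0 + 1) / 3)
    · exact key 2 0 (by simp) (by simp) (by linarith) c3
    · exact key 2 2 (by simp) (by simp) (by linarith) (by norm_num; exact h1)

lemma one_mem_preCantorSet' (n : ℕ) : (1:ℝ) ∈ preCantorSet n := by
  induction n with
  | zero => simp
  | succ n ih => exact Or.inr ⟨1, ih, by norm_num⟩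

lemma ConeMono.image_eq {g : ℝ × ℝ → ℝ} (hg : ConeMono g) :
    g '' (cantorSet ×ˢ cantorSet) = Set.Icc (g (0, 0)) (g (1, 1)) := by
  apply Set.Subset.antisymm
  · rintro _ ⟨⟨x, y⟩, ⟨hx, hy⟩, rfl⟩
    have hx' := cantorSet_subset_unitInterval hx
    have hy' := cantorSet_subset_unitInterval hy
    obtain ⟨_, _⟩ := hx'
    obtain ⟨_, _⟩ := hy'
    constructor <;> apply hg.2 <;> first | constructor <;> linarith | linarith
  · rintro z ⟨h0, h1⟩
    have hcl : ∀ n, IsClosed ((preCantorSet n ×ˢ preCantorSet n) ∩ g ⁻¹' {z}) := fun n =>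
      ((isClosed_preCantorSet n).prod (isClosed_preCantorSet n)).inter
        (isClosed_singleton.preimage hg.1)
    obtain ⟨p, hp⟩ := IsCompact.nonempty_iInter_of_sequence_nonempty_isCompact_isClosed
      (fun n => (preCantorSet n ×ˢ preCantorSet n) ∩ g ⁻¹' {z})
      (fun n => Set.inter_subset_inter_left _
        (Set.prod_mono (preCantorSet_antitone n.le_succ) (preCantorSet_antitone n.le_succ)))
      (fun n => by
        obtain ⟨x, hx, y, hy, hz⟩ := ConeMono.surj n hg z h0 h1
        exact ⟨(x, y), ⟨hx, hy⟩, hz⟩)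
      ((isCompact_Icc.prod isCompact_Icc).of_isClosed_subset (hcl 0)
        (fun q hq => hq.1)) hcl
    rw [Set.mem_iInter] at hp
    exact ⟨p, ⟨Set.mem_iInter.2 fun n => (hp n).1.1, Set.mem_iInter.2 fun n => (hp n).1.2⟩,
      (hp 0).2⟩

theorem stmt_12 (f : ℝ × ℝ → ℝ) (hf : ContDiff ℝ 3 f)
    (hx : ∀ p ∈ Set.Icc 0 1 ×ˢ Set.Icc 0 1, 0 < pdx f p)
    (hy : ∀ p ∈ Set.Icc 0 1 ×ˢ Set.Icc 0 1, 0 < pdy f p)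
    (hxx : ∀ p ∈ Set.Icc 0 1 ×ˢ Set.Icc 0 1, 0 ≤ pdxx f p)
    (hxy : ∀ p ∈ Set.Icc 0 1 ×ˢ Set.Icc 0 1, pdxy f p ≤ 0)
    (hyy : ∀ p ∈ Set.Icc 0 1 ×ˢ Set.Icc 0 1, 0 ≤ pdyy f p)
    (hratio : ∀ p ∈ Set.Icc 0 1 ×ˢ Set.Icc 0 1,
      1 / 3 ≤ pdy f p / pdx f p ∧ pdy f p / pdx f p ≤ 1) :
    ∃ a b : ℝ, a ≤ b ∧ f '' (cantorSet ×ˢ cantorSet) = Set.Icc a b := by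
  have hg : ConeMono f := by
    refine ⟨hf.continuous, ?_⟩
    intro x y x' y' h1 h2 h3 h4 hc1 hc2
    have hd : Differentiable ℝ f := hf.differentiable (by norm_num)
    have hder : ∀ t : ℝ, HasDerivAt (fun t : ℝ => f ((x, y) + t • (x' - x, y' - y)))
        (fderiv ℝ f ((x, y) + t • (x' - x, y' - y)) (x' - x, y' - y)) t := by
      intro t
      have hl : HasDerivAt (fun t : ℝ => (x, y) + t • (x' - x, y' - y)) (x' - x, y' - y) t := by
        simpa using ((hasDerivAt_id t).smul_const (x' - x, y' - y)).const_add (x, y)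
      exact (hd _).hasFDerivAt.comp_hasDerivAt t hl
    have hmono : MonotoneOn (fun t : ℝ => f ((x, y) + t • (x' - x, y' - y)))
        (Set.Icc 0 1) := by
      apply monotoneOn_of_deriv_nonneg (convex_Icc 0 1)
      · exact fun t _ => (hder t).continuousAt.continuousWithinAt
      · exact fun t _ => (hder t).differentiableAt.differentiableWithinAt
      · intro t ht
        rw [interior_Icc] at ht
        rw [(hder t).deriv]
        set p := (x, y) + t • (x' - x, y' - y) with hp
        have hmem : p ∈ Set.Icc (0:ℝ) 1 ×ˢ Set.Icc (0:ℝ) 1 :=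
          ((convex_Icc (0:ℝ) 1).prod (convex_Icc (0:ℝ) 1)).add_smul_sub_mem
            (x := (x, y)) (y := (x', y')) (Set.mk_mem_prod h1 h2) (Set.mk_mem_prod h3 h4) ⟨ht.1.le, ht.2.le⟩
        have hpx := hx p hmem
        obtain ⟨r1, r2⟩ := hratio p hmem
        rw [le_div_iff₀ hpx] at r1
        rw [div_le_iff₀ hpx] at r2
        have heq : fderiv ℝ f p (x' - x, y' - y)
            = (x' - x) * pdx f p + (y' - y) * pdy f p := by
          have : (x' - x, y' - y) = (x' - x) • ((1:ℝ), (0:ℝ)) + (y' - y) • ((0:ℝ), (1:ℝ)) := by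
            simp
          rw [this, map_add, map_smul, map_smul]
          rfl
        rw [heq]
        nlinarith [mul_nonneg hc1 (by linarith : 0 ≤ 3 * pdy f p - pdx f p),
          mul_nonneg hc2 (by linarith : 0 ≤ pdx f p - pdy f p)]
    have := hmono (Set.left_mem_Icc.2 zero_le_one) (Set.right_mem_Icc.2 zero_le_one) zero_le_one
    simpa using this
  refine ⟨f (0, 0), f (1, 1), ?_, hg.image_eq⟩
  apply hg.2 <;> norm_num
end

section
/- Let C be the middle-third Cantor set. Then C + C = {x + y : x, y ∈ C} = [0,2] and C − C = {x − y : x, y ∈ C} = [−1,1]. -/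
theorem pre_left {n : ℕ} {x : ℝ} (h : x ∈ preCantorSet n) : x / 3 ∈ preCantorSet (n + 1) := by
  rw [preCantorSet_succ]
  exact Or.inl ⟨x, h, rfl⟩

theorem pre_right {n : ℕ} {x : ℝ} (h : x ∈ preCantorSet n) :
    (2 + x) / 3 ∈ preCantorSet (n + 1) := by
  rw [preCantorSet_succ]
  exact Or.inr ⟨x, h, rfl⟩

theorem pre_symm (n : ℕ) : ∀ x ∈ preCantorSet n, 1 - x ∈ preCantorSet n := by
  induction n with
  | zero =>
    intro x hx
    simp only [preCantorSet_zero, Set.mem_Icc] at *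
    constructor <;> linarith
  | succ n ih =>
    intro x hx
    rw [preCantorSet_succ] at hx
    rcases hx with ⟨y, hy, rfl⟩ | ⟨y, hy, rfl⟩
    · convert pre_right (ih y hy) using 1
      ring
    · convert pre_left (ih y hy) using 1
      ring

theorem pre_sum (n : ℕ) : ∀ t : ℝ, 0 ≤ t → t ≤ 2 →
    ∃ x ∈ preCantorSet n, t - x ∈ preCantorSet n := by
  induction n with
  | zero =>
    intro t h0 h2
    refine ⟨t / 2, ?_, ?_⟩ <;> simp only [preCantorSet_zero, Set.mem_Icc] <;>
      constructor <;> linarith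
  | succ n ih =>
    intro t h0 h2
    rcases le_total (3 * t) 2 with h | h
    · obtain ⟨x, hx, hy⟩ := ih (3 * t) (by linarith) h
      refine ⟨_, pre_left hx, ?_⟩
      convert pre_left hy using 1
      ring
    rcases le_total (3 * t) 4 with h' | h'
    · obtain ⟨x, hx, hy⟩ := ih (3 * t - 2) (by linarith) (by linarith)
      refine ⟨_, pre_right hx, ?_⟩
      convert pre_left hy using 1
      ring
    · obtain ⟨x, hx, hy⟩ := ih (3 * t - 4) (by linarith) (by linarith)
      refine ⟨_, pre_right hx, ?_⟩
      convert pre_right hy using 1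
      ring

theorem cantor_sum (t : ℝ) (h0 : 0 ≤ t) (h2 : t ≤ 2) :
    ∃ x ∈ cantorSet, t - x ∈ cantorSet := by
  have hc : ∀ n, IsClosed (preCantorSet n ∩ (fun x => t - x) ⁻¹' preCantorSet n) := fun n =>
    (isClosed_preCantorSet n).inter ((isClosed_preCantorSet n).preimage (by fun_prop))
  obtain ⟨x, hx⟩ := IsCompact.nonempty_iInter_of_sequence_nonempty_isCompact_isClosed
    (fun n => preCantorSet n ∩ (fun x => t - x) ⁻¹' preCantorSet n)
    (fun n => Set.inter_subset_inter (preCantorSet_antitone n.le_succ)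
      (Set.preimage_mono (preCantorSet_antitone n.le_succ)))
    (fun n => by
      obtain ⟨x, hx, hy⟩ := pre_sum n t h0 h2
      exact ⟨x, hx, hy⟩)
    (isCompact_Icc.of_isClosed_subset (hc 0)
      (Set.inter_subset_left.trans preCantorSet_subset_unitInterval)) hc
  rw [Set.mem_iInter] at hx
  exact ⟨x, Set.mem_iInter.2 fun n => (hx n).1, Set.mem_iInter.2 fun n => (hx n).2⟩

theorem cantor_symm {x : ℝ} (hx : x ∈ cantorSet) : 1 - x ∈ cantorSet :=
  Set.mem_iInter.2 fun n => pre_symm n x (Set.mem_iInter.1 hx n)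

theorem stmt_13 :
    Set.image2 (· + ·) cantorSet cantorSet = Set.Icc (0 : ℝ) 2 ∧
    Set.image2 (· - ·) cantorSet cantorSet = Set.Icc (-1 : ℝ) 1 := by
  constructor
  · ext t
    constructor
    · rintro ⟨x, hx, y, hy, rfl⟩
      have h1 := cantorSet_subset_unitInterval hx
      have h2 := cantorSet_subset_unitInterval hy
      exact ⟨by linarith [h1.1, h2.1], by linarith [h1.2, h2.2]⟩
    · rintro ⟨h0, h2⟩
      obtain ⟨x, hx, hy⟩ := cantor_sum t h0 h2
      exact ⟨x, hx, t - x, hy, by ring⟩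
  · ext t
    constructor
    · rintro ⟨x, hx, y, hy, rfl⟩
      have h1 := cantorSet_subset_unitInterval hx
      have h2 := cantorSet_subset_unitInterval hy
      exact ⟨by linarith [h1.1, h2.2], by linarith [h1.2, h2.1]⟩
    · rintro ⟨h0, h2⟩
      obtain ⟨x, hx, hy⟩ := cantor_sum (t + 1) (by linarith) (by linarith)
      exact ⟨x, hx, _, cantor_symm hy, by ring⟩
end

section
/- Let K ⊆ ℝ be the attractor of the IFS {x ↦ x/3, x ↦ x/4, x ↦ (x+2)/3}, i.e. the unique nonempty compact set with K = K/3 ∪ K/4 ∪ ((K+2)/3). Let f(x,y) = x² + y² + αx + βy + γxy, where the real parameters satisfy 2 + α + γ < 3β, α > 2 + β + γ, α > 0, β > 0, and 0 < γ < 2. Then f(K, K) = {f(x,y) : x, y ∈ K} = [0, 2 + α + β + γ], which equals the image f([0,1]×[0,1]). -/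
theorem stmt_14 (K : Set ℝ) (hKc : IsCompact K) (hKne : K.Nonempty)
    (hK : K = (fun x => x / 3) '' K ∪ (fun x => x / 4) '' K ∪ (fun x => (x + 2) / 3) '' K)
    (α β γ : ℝ) (h1 : 2 + α + γ < 3 * β) (h2 : 2 + β + γ < α)
    (hα : 0 < α) (hβ : 0 < β) (hγ0 : 0 < γ) (hγ2 : γ < 2)
    (f : ℝ → ℝ → ℝ)
    (hf : f = fun x y => x ^ 2 + y ^ 2 + α * x + β * y + γ * x * y) :
    Set.image2 f K K = Set.Icc (0 : ℝ) (2 + α + β + γ) ∧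
    Set.image2 f K K = Set.image2 f (Set.Icc 0 1) (Set.Icc 0 1) := by
  have hmem : ∀ x ∈ K, x / 3 ∈ K ∧ (x + 2) / 3 ∈ K := by
    intro x hx
    constructor
    · rw [hK]; exact Or.inl (Or.inl ⟨x, hx, rfl⟩)
    · rw [hK]; exact Or.inr ⟨x, hx, rfl⟩
  have hK01 : K ⊆ Set.Icc 0 1 := by
    obtain ⟨M, hM, hMax⟩ := hKc.exists_isGreatest hKne
    obtain ⟨m, hm, hMin⟩ := hKc.exists_isLeast hKne
    have hM1 : M ≤ 1 := by
      have h := hM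
      rw [hK] at h
      rcases h with (⟨x, hx, h⟩ | ⟨x, hx, h⟩) | ⟨x, hx, h⟩ <;>
        · have := hMax hx
          simp only at h
          linarith
    have hm0 : 0 ≤ m := by
      have h := hm
      rw [hK] at h
      rcases h with (⟨x, hx, h⟩ | ⟨x, hx, h⟩) | ⟨x, hx, h⟩ <;>
        · have := hMin hx
          simp only at h
          linarith
    intro x hx
    exact ⟨hm0.trans (hMin hx), (hMax hx).trans hM1⟩
  have hmono : ∀ a b c d : ℝ, 0 ≤ a → 0 ≤ b → a ≤ c → b ≤ d → f a b ≤ f c d := by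
    intro a b c d ha hb hac hbd
    have e1 : a * b ≤ c * d := mul_le_mul hac hbd hb (ha.trans hac)
    have e2 : γ * (a * b) ≤ γ * (c * d) := mul_le_mul_of_nonneg_left e1 hγ0.le
    have e3 : a ^ 2 ≤ c ^ 2 := pow_le_pow_left₀ ha hac 2
    have e4 : b ^ 2 ≤ d ^ 2 := pow_le_pow_left₀ hb hbd 2
    have e5 := mul_le_mul_of_nonneg_left hac hα.le
    have e6 := mul_le_mul_of_nonneg_left hbd hβ.le
    simp only [hf]
    linarith
  -- x-increment of length h against y-increment of length h
  have hstep1 : ∀ a b h : ℝ, 0 ≤ a → 0 ≤ b → 0 ≤ h → a + h ≤ 1 → b + h ≤ 1 →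
      f a (b + h) ≤ f (a + h) b := by
    intro a b h ha hb hh hah hbh
    have e : f (a + h) b - f a (b + h) = h * (2 * a - 2 * b + α - β + γ * (b - a)) := by
      simp only [hf]; ring
    have : 0 ≤ 2 * a - 2 * b + α - β + γ * (b - a) := by nlinarith
    have := mul_nonneg hh this
    linarith
  have hstep2 : ∀ a b h : ℝ, 0 ≤ a → 0 ≤ b → 0 ≤ h → a + h ≤ 1 → b + 3 * h ≤ 1 →
      f (a + h) b ≤ f a (b + 3 * h) := by
    intro a b h ha hb hh hah hbh
    have e : f a (b + 3 * h) - f (a + h) b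
        = h * (6 * b + 9 * h + 3 * β + 3 * γ * a - 2 * a - h - α - γ * b) := by
      simp only [hf]; ring
    have : 0 ≤ 6 * b + 9 * h + 3 * β + 3 * γ * a - 2 * a - h - α - γ * b := by
      have := mul_nonneg hγ0.le ha
      have : γ * b ≤ γ * 1 := mul_le_mul_of_nonneg_left (by linarith) hγ0.le
      linarith
    have := mul_nonneg hh this
    linarith
  have hind : ∀ t ∈ Set.Icc (0 : ℝ) (2 + α + β + γ), ∀ n : ℕ, ∃ a b : ℝ,
      (∀ x ∈ K, a + (1 / 3) ^ n * x ∈ K) ∧ (∀ x ∈ K, b + (1 / 3) ^ n * x ∈ K) ∧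
      0 ≤ a ∧ a + (1 / 3) ^ n ≤ 1 ∧ 0 ≤ b ∧ b + (1 / 3) ^ n ≤ 1 ∧
      f a b ≤ t ∧ t ≤ f (a + (1 / 3) ^ n) (b + (1 / 3) ^ n) := by
    intro t ht n
    induction n with
    | zero =>
      refine ⟨0, 0, ?_, ?_, le_rfl, ?_, le_rfl, ?_, ?_, ?_⟩
      · simp
      · simp
      · simp
      · simp
      · simpa [hf] using ht.1
      · have := ht.2
        simp only [hf]
        norm_num
        linarith
    | succ n ih =>
      obtain ⟨a, b, hKa, hKb, ha, ha1, hb, hb1, hl, hu⟩ := ih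
      have hd : (1 / 3 : ℝ) ^ n = 3 * (1 / 3 : ℝ) ^ (n + 1) := by
        rw [pow_succ]; ring
      have hpos : (0 : ℝ) < (1 / 3 : ℝ) ^ (n + 1) := by positivity
      rw [hd] at hKa hKb ha1 hb1 hu
      generalize (1 / 3 : ℝ) ^ (n + 1) = e at *
      have key : ∀ c : ℝ, (∀ x ∈ K, c + 3 * e * x ∈ K) →
          (∀ x ∈ K, c + e * x ∈ K) ∧ (∀ x ∈ K, c + 2 * e + e * x ∈ K) := by
        intro c hc
        constructor
        · intro x hx
          have := hc _ (hmem x hx).1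
          convert this using 1; ring
        · intro x hx
          have := hc _ (hmem x hx).2
          convert this using 1; ring
      obtain ⟨ka1, ka2⟩ := key a hKa
      obtain ⟨kb1, kb2⟩ := key b hKb
      by_cases c1 : t ≤ f (a + e) (b + e)
      · exact ⟨a, b, ka1, kb1, ha, by linarith, hb, by linarith, hl, c1⟩
      push Not at c1
      have s1 := hstep1 a (b + e) e ha (by linarith) hpos.le (by linarith) (by linarith)
      rw [show b + e + e = b + 2 * e by ring] at s1
      by_cases c2 : t ≤ f (a + e) (b + 2 * e + e)
      · exact ⟨a, b + 2 * e, ka1, kb2, ha, by linarith, by linarith, by linarith,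
          by linarith, c2⟩
      push Not at c2
      have s2 := hstep2 (a + e) b e (by linarith) hb hpos.le (by linarith) (by linarith)
      rw [show a + e + e = a + 2 * e by ring, show b + 3 * e = b + 2 * e + e by ring] at s2
      by_cases c3 : t ≤ f (a + 2 * e + e) (b + e)
      · exact ⟨a + 2 * e, b, ka2, kb1, by linarith, by linarith, hb, by linarith,
          by linarith, c3⟩
      push Not at c3
      have s3 := hstep1 (a + 2 * e) (b + e) e (by linarith) (by linarith) hpos.le
        (by linarith) (by linarith)
      rw [show b + e + e = b + 2 * e by ring] at s3
      refine ⟨a + 2 * e, b + 2 * e, ka2, kb2, by linarith, by linarith, by linarith,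
        by linarith, by linarith, ?_⟩
      rw [show a + 2 * e + e = a + 3 * e by ring, show b + 2 * e + e = b + 3 * e by ring]
      exact hu
  have hfc : Continuous (fun p : ℝ × ℝ => f p.1 p.2) := by
    simp only [hf]; fun_prop
  have hcl : IsClosed (Set.image2 f K K) := by
    rw [← Set.image_prod]
    exact ((hKc.prod hKc).image hfc).isClosed
  have hsup : Set.Icc (0 : ℝ) (2 + α + β + γ) ⊆ Set.image2 f K K := by
    intro t ht
    rw [← hcl.closure_eq, Metric.mem_closure_iff]
    intro ε hε
    obtain ⟨k, hk⟩ := hKne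
    obtain ⟨hk0, hk1⟩ := hK01 hk
    have hC : 0 < 4 + α + β + 2 * γ := by linarith
    obtain ⟨n, hn⟩ := exists_pow_lt_of_lt_one (div_pos hε hC) (by norm_num : (1 / 3 : ℝ) < 1)
    rw [lt_div_iff₀ hC] at hn
    obtain ⟨a, b, hKa, hKb, ha, ha1, hb, hb1, hl, hu⟩ := hind t ht n
    have hpos : (0 : ℝ) < (1 / 3 : ℝ) ^ n := by positivity
    refine ⟨_, Set.mem_image2_of_mem (hKa k hk) (hKb k hk), ?_⟩
    generalize (1 / 3 : ℝ) ^ n = e at *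
    have q0 : 0 ≤ e * k := mul_nonneg hpos.le hk0
    have q1 : e * k ≤ e := by nlinarith
    have m1 := hmono a b (a + e * k) (b + e * k) ha hb (by linarith) (by linarith)
    have m2 := hmono (a + e * k) (b + e * k) (a + e) (b + e) (by linarith) (by linarith)
      (by linarith) (by linarith)
    have e1 : f (a + e) (b + e) - f a b
        = e * (2 * a + e + 2 * b + e + α + β + γ * (a + b + e)) := by
      simp only [hf]; ring
    have e2 : γ * (a + b + e) ≤ γ * 2 := mul_le_mul_of_nonneg_left (by linarith) hγ0.le
    have e3 : e * (2 * a + e + 2 * b + e + α + β + γ * (a + b + e))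
        ≤ e * (4 + α + β + 2 * γ) := mul_le_mul_of_nonneg_left (by linarith) hpos.le
    rw [Real.dist_eq, abs_lt]
    constructor <;> linarith
  have hsub : Set.image2 f (Set.Icc 0 1) (Set.Icc 0 1) ⊆ Set.Icc (0 : ℝ) (2 + α + β + γ) := by
    rintro _ ⟨x, ⟨hx0, hx1⟩, y, ⟨hy0, hy1⟩, rfl⟩
    have m1 := hmono 0 0 x y le_rfl le_rfl hx0 hy0
    have m2 := hmono x y 1 1 hx0 hy0 hx1 hy1
    have v0 : f 0 0 = 0 := by simp [hf]
    have v1 : f 1 1 = 2 + α + β + γ := by simp only [hf]; ring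
    constructor <;> linarith
  have hmid : Set.image2 f K K ⊆ Set.image2 f (Set.Icc 0 1) (Set.Icc 0 1) :=
    Set.image2_subset hK01 hK01
  exact ⟨(hmid.trans hsub).antisymm hsup, hmid.antisymm (hsub.trans hsup)⟩
end

section
/- Let K ⊆ ℝ be the attractor of the IFS {x ↦ x/3, x ↦ x/4, x ↦ (x+2)/3}, i.e. the unique nonempty compact set with K = K/3 ∪ K/4 ∪ ((K+2)/3). Let f(x,y) = sin(αxy) + βx + γy, where −1 < α < 0, β > 10, and γ = β/2. Then f(K, K) = {f(x,y) : x, y ∈ K} = [0, sin(α) + 3β/2], which equals the image f([0,1]×[0,1]). -/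
theorem incr_aux (α β : ℝ) (hα0 : -1 < α) (hα1 : α < 0) (x y x' y' : ℝ)
    (hy0 : 0 ≤ y) (hy1 : y ≤ 1) (hx0' : 0 ≤ x') (hx1' : x' ≤ 1) :
    |(Real.sin (α * x' * y') + β * x' + β / 2 * y') - (Real.sin (α * x * y) + β * x + β / 2 * y)
      - (β * (x' - x) + β / 2 * (y' - y))| ≤ |x' - x| + |y' - y| := by
  have h1 : |Real.sin (α * x' * y') - Real.sin (α * x * y)| ≤ |α * x' * y' - α * x * y| := by
    have h := Real.lipschitzWith_sin.dist_le_mul (α * x' * y') (α * x * y)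
    simpa [Real.dist_eq] using h
  have h2 : α * x' * y' - α * x * y = α * (x' * (y' - y) + (x' - x) * y) := by ring
  have h3 : |α| ≤ 1 := abs_le.mpr ⟨by linarith, by linarith⟩
  have h4 : |x' * (y' - y) + (x' - x) * y| ≤ |x' - x| + |y' - y| := by
    refine (abs_add_le _ _).trans ?_
    rw [abs_mul, abs_mul, abs_of_nonneg hx0', abs_of_nonneg hy0]
    nlinarith [abs_nonneg (x' - x), abs_nonneg (y' - y)]
  have h5 : |α * x' * y' - α * x * y| ≤ |x' - x| + |y' - y| := by
    rw [h2, abs_mul]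
    nlinarith [abs_nonneg (x' * (y' - y) + (x' - x) * y), abs_nonneg α]
  have h6 : (Real.sin (α * x' * y') + β * x' + β / 2 * y')
      - (Real.sin (α * x * y) + β * x + β / 2 * y)
      - (β * (x' - x) + β / 2 * (y' - y)) = Real.sin (α * x' * y') - Real.sin (α * x * y) := by
    ring
  rw [h6]
  exact h1.trans h5

theorem stmt_15 (K : Set ℝ) (hKc : IsCompact K) (hKne : K.Nonempty)
    (hK : K = (fun x => x / 3) '' K ∪ (fun x => x / 4) '' K ∪ (fun x => (x + 2) / 3) '' K)
    (α β γ : ℝ) (hα0 : -1 < α) (hα1 : α < 0) (hβ : 10 < β) (hγ : γ = β / 2)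
    (f : ℝ → ℝ → ℝ)
    (hf : f = fun x y => Real.sin (α * x * y) + β * x + γ * y) :
    Set.image2 f K K = Set.Icc (0 : ℝ) (Real.sin α + 3 * β / 2) ∧
    Set.image2 f K K = Set.image2 f (Set.Icc 0 1) (Set.Icc 0 1) := by
  subst hγ
  have k3 : ∀ k ∈ K, k / 3 ∈ K := fun k hk => by
    rw [hK]; exact Or.inl (Or.inl ⟨k, hk, rfl⟩)
  have k2 : ∀ k ∈ K, (k + 2) / 3 ∈ K := fun k hk => by
    rw [hK]; exact Or.inr ⟨k, hk, rfl⟩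
  have kc : ∀ k ∈ K, ∃ j ∈ K, k = j / 3 ∨ k = j / 4 ∨ k = (j + 2) / 3 := fun k hk => by
    rw [hK] at hk
    rcases hk with (⟨j, hj, h⟩ | ⟨j, hj, h⟩) | ⟨j, hj, h⟩
    · exact ⟨j, hj, Or.inl h.symm⟩
    · exact ⟨j, hj, Or.inr (Or.inl h.symm)⟩
    · exact ⟨j, hj, Or.inr (Or.inr h.symm)⟩
  obtain ⟨m, hm, hmin⟩ := hKc.exists_isLeast hKne
  obtain ⟨M, hM, hmax⟩ := hKc.exists_isGreatest hKne
  have hm0 : m = 0 := by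
    have h1 := hmin (k3 m hm)
    obtain ⟨j, hj, h⟩ := kc m hm
    have h2 := hmin hj
    rcases h with h | h | h <;> linarith
  have hM1 : M ≤ 1 := by
    obtain ⟨j, hj, h⟩ := kc M hM
    have h2 := hmax hj
    rcases h with h | h | h <;> linarith
  subst hm0
  have hsub : K ⊆ Set.Icc 0 1 := fun k hk => ⟨hmin hk, (hmax hk).trans hM1⟩
  have inc : ∀ x y x' y' : ℝ, 0 ≤ y → y ≤ 1 → 0 ≤ x' → x' ≤ 1 →
      |f x' y' - f x y - (β * (x' - x) + β / 2 * (y' - y))| ≤ |x' - x| + |y' - y| := by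
    intro x y x' y' a b c d
    rw [hf]
    exact incr_aux α β hα0 hα1 x y x' y' a b c d
  have f0 : f 0 0 = 0 := by simp [hf]
  have f1 : f 1 1 = Real.sin α + 3 * β / 2 := by simp [hf]; ring
  have mono : ∀ x y x' y' : ℝ, 0 ≤ y → y ≤ 1 → 0 ≤ x' → x' ≤ 1 → x ≤ x' → y ≤ y' →
      f x y ≤ f x' y' := by
    intro x y x' y' a b c d e g
    have h := (abs_le.mp (inc x y x' y' a b c d)).1
    rw [abs_of_nonneg (sub_nonneg.2 e), abs_of_nonneg (sub_nonneg.2 g)] at h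
    nlinarith
  have s1 : Set.image2 f K K ⊆ Set.image2 f (Set.Icc 0 1) (Set.Icc 0 1) :=
    Set.image2_subset hsub hsub
  have s2 : Set.image2 f (Set.Icc 0 1) (Set.Icc 0 1) ⊆
      Set.Icc (0 : ℝ) (Real.sin α + 3 * β / 2) := by
    rintro _ ⟨x, ⟨hx0, hx1⟩, y, ⟨hy0, hy1⟩, rfl⟩
    rw [← f1]
    constructor
    · rw [← f0]
      exact mono 0 0 x y le_rfl zero_le_one hx0 hx1 hx0 hy0
    · exact mono x y 1 1 hy0 hy1 zero_le_one le_rfl hx1 hy1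
  have s3 : Set.Icc (0 : ℝ) (Real.sin α + 3 * β / 2) ⊆ Set.image2 f K K := by
    intro c hc
    rw [← f1, ← f0] at hc
    have main : ∀ n : ℕ, ∃ h x y : ℝ, h = (1 / 3) ^ n ∧ 0 < h ∧ 0 ≤ x ∧ 0 ≤ y ∧ x + h ≤ 1 ∧
        y + h ≤ 1 ∧ (∀ k ∈ K, x + h * k ∈ K) ∧ (∀ k ∈ K, y + h * k ∈ K) ∧
        f x y ≤ c ∧ c ≤ f (x + h) (y + h) := by
      intro n
      induction n with
      | zero =>
        exact ⟨1, 0, 0, by simp, one_pos, le_rfl, le_rfl, by simp, by simp, by simp, by simp,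
          hc.1, by simpa using hc.2⟩
      | succ n ih =>
        obtain ⟨h, x, y, hh, hp, hx, hy, hx1, hy1, px, py, c1, c2⟩ := ih
        have low : ∀ z : ℝ, (∀ k ∈ K, z + h * k ∈ K) → ∀ k ∈ K, z + h / 3 * k ∈ K := by
          intro z pz k hk
          have := pz _ (k3 k hk)
          convert this using 1; ring
        have up : ∀ z : ℝ, (∀ k ∈ K, z + h * k ∈ K) → ∀ k ∈ K, z + 2 * h / 3 + h / 3 * k ∈ K := by
          intro z pz k hk
          have := pz _ (k2 k hk)
          convert this using 1; ring
        have hh' : h / 3 = (1 / 3) ^ (n + 1) := by rw [pow_succ, ← hh]; ring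
        have A : ∀ u v : ℝ, 0 ≤ v → v + h / 3 ≤ 1 → 0 ≤ u → u + h / 3 ≤ 1 →
            f u (v + h / 3) ≤ f (u + h / 3) v := by
          intro u v a b d e
          have h := (abs_le.mp (inc u (v + h / 3) (u + h / 3) v (by linarith) (by linarith)
            (by linarith) (by linarith))).1
          rw [abs_of_nonneg (by linarith), abs_of_nonpos (by linarith)] at h
          nlinarith
        have B : f (x + 2 * h / 3) y ≤ f (x + h / 3) (y + h) := by
          have h := (abs_le.mp (inc (x + 2 * h / 3) y (x + h / 3) (y + h) (by linarith)
            (by linarith) (by linarith) (by linarith))).1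
          rw [abs_of_nonpos (by linarith), abs_of_nonneg (by linarith)] at h
          nlinarith
        have A1 : f x (y + 2 * h / 3) ≤ f (x + h / 3) (y + h / 3) := by
          have := A x (y + h / 3) (by linarith) (by linarith) (by linarith) (by linarith)
          convert this using 2; ring
        have A2 : f (x + 2 * h / 3) (y + 2 * h / 3) ≤ f (x + h) (y + h / 3) := by
          have := A (x + 2 * h / 3) (y + h / 3) (by linarith) (by linarith) (by linarith)
            (by linarith)
          convert this using 2 <;> ring
        have ex : x + 2 * h / 3 + h / 3 = x + h := by ring
        have ey : y + 2 * h / 3 + h / 3 = y + h := by ring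
        by_cases t1 : c ≤ f (x + h / 3) (y + h / 3)
        · exact ⟨h / 3, x, y, hh', by linarith, hx, hy, by linarith, by linarith,
            low x px, low y py, c1, t1⟩
        by_cases t2 : c ≤ f (x + h / 3) (y + h)
        · exact ⟨h / 3, x, y + 2 * h / 3, hh', by linarith, hx, by linarith, by linarith,
            by linarith, low x px, up y py, by linarith, by rw [ey]; exact t2⟩
        by_cases t3 : c ≤ f (x + h) (y + h / 3)
        · exact ⟨h / 3, x + 2 * h / 3, y, hh', by linarith, by linarith, hy, by linarith,
            by linarith, up x px, low y py, by linarith, by rw [ex]; exact t3⟩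
        · exact ⟨h / 3, x + 2 * h / 3, y + 2 * h / 3, hh', by linarith, by linarith, by linarith,
            by linarith, by linarith, up x px, up y py, by linarith, by rw [ex, ey]; exact c2⟩
    have hcont : Continuous (fun p : ℝ × ℝ => f p.1 p.2) := by
      rw [hf]; fun_prop
    have hcl : IsClosed (Set.image2 f K K) := by
      rw [← Set.image_prod]
      exact ((hKc.prod hKc).image hcont).isClosed
    rw [← hcl.closure_eq, Metric.mem_closure_iff]
    intro ε hε
    have hB : 0 < 3 * β / 2 + 2 := by linarith
    obtain ⟨n, hn⟩ := exists_pow_lt_of_lt_one (div_pos hε hB) (by norm_num : (1 / 3 : ℝ) < 1)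
    obtain ⟨h, x, y, hh, hp, hx, hy, hx1, hy1, px, py, c1, c2⟩ := main n
    refine ⟨f x y, ⟨x, by simpa using px 0 hm, y, by simpa using py 0 hm, rfl⟩, ?_⟩
    have hi := (abs_le.mp (inc x y (x + h) (y + h) hy (by linarith) (by linarith) hx1)).2
    rw [abs_of_nonneg (by linarith), abs_of_nonneg (by linarith)] at hi
    rw [← hh, lt_div_iff₀ hB] at hn
    rw [Real.dist_eq, abs_of_nonneg (by linarith)]
    nlinarith
  exact ⟨(s1.trans s2).antisymm s3, s1.antisymm (s2.trans s3)⟩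
end
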